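/- Theorem 4: with the weight sequences s_0 = 1+t+t², s_k = 1+t² for k ≥ 1, and t_k = t² for all k (in ℤ[t]), the Jacobi-type array satisfies a(n,0) = c_{2n+1}(t) for all n ≥ 0; i.e., the generating function Σ_{n≥0} c_{2n+1}(t) z^n has the Jacobi continued fraction expansion with s_0 = 1+t+t², s_n = 1+t² for n > 0, and t_n = t². -/

import Mathlib

open Polynomial Finset

/-- The Jacobi-type array: `a 0 k = [k = 0]`, and
`a (n+1) k = a n (k-1) + s k * a n k + t k * a n (k+1)` with `a n (-1) = 0`. -/
def jacobiA {R : Type*} [CommRing R] (s t : ℕ → R) : ℕ → ℕ → R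
  | 0, k => if k = 0 then 1 else 0
  | n+1, k =>
      (if k = 0 then 0 else jacobiA s t n (k-1)) + s k * jacobiA s t n k
        + t k * jacobiA s t n (k+1)

/-- The Narayana polynomial `C_n(t) ∈ ℤ[t]`:
`C_0(t) = 1` and `C_n(t) = ∑_{k=0}^{n-1} (1/(k+1))·binom(n,k)·binom(n-1,k)·t^k` for `n ≥ 1`. -/
noncomputable def narayana (n : ℕ) : Polynomial ℤ :=
  if n = 0 then 1 else
    ∑ k ∈ Finset.range n,
      Polynomial.C ((n.choose k * (n-1).choose k / (k+1) : ℕ) : ℤ) * Polynomial.X ^ k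

/-- The polynomial `c_n(t) = C_n(t;-1) ∈ ℤ[t]`: `c_0(t) = 1` and
`c_n(t) = ∑_{k=0}^{n} binom(⌊(n-1)/2⌋,⌊k/2⌋)·binom(⌊n/2⌋,⌊(k+1)/2⌋)·t^k` for `n ≥ 1`. -/
noncomputable def cnar (n : ℕ) : Polynomial ℤ :=
  if n = 0 then 1 else
    ∑ k ∈ Finset.range (n+1),
      Polynomial.C ((((n-1)/2).choose (k/2) * (n/2).choose ((k+1)/2) : ℕ) : ℤ) * Polynomial.X ^ k


/-- The coefficient of `x ^ k` in `(1 + x) ^ n * (1 + y / x) ^ m`. -/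
def laurentCoeff {R : Type*} [CommRing R] (y : R) (m n k : ℕ) : R :=
  ∑ j ∈ Finset.range (m + 1), (m.choose j : R) * (n.choose (j + k) : R) * y ^ j

section laurentCoeff

variable {R : Type*} [CommRing R] (y : R)

theorem laurentCoeff_zero (k : ℕ) :
    laurentCoeff y 0 0 k = if k = 0 then 1 else 0 := by
  cases k <;> simp [laurentCoeff]

theorem laurentCoeff_succ_right (m n k : ℕ) :
    laurentCoeff y m (n + 1) (k + 1) = laurentCoeff y m n k + laurentCoeff y m n (k + 1) := by
  simp only [laurentCoeff, ← Finset.sum_add_distrib]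
  refine Finset.sum_congr rfl fun j _ => ?_
  rw [← add_assoc, Nat.choose_succ_succ']
  push_cast
  ring

theorem laurentCoeff_succ_left (m n k : ℕ) :
    laurentCoeff y (m + 1) n k = laurentCoeff y m n k + y * laurentCoeff y m n (k + 1) := by
  have h : laurentCoeff y m n k =
      ∑ j ∈ Finset.range (m + 1),
        (m.choose (j + 1) : R) * (n.choose (j + 1 + k) : R) * y ^ (j + 1) + n.choose k := by
    rw [laurentCoeff, Finset.sum_range_succ', Finset.sum_range_succ _ m]
    simp
  rw [h, laurentCoeff, Finset.sum_range_succ', laurentCoeff, Finset.mul_sum, add_right_comm,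
    ← Finset.sum_add_distrib]
  congr 1
  · refine Finset.sum_congr rfl fun j _ => ?_
    rw [Nat.choose_succ_succ', add_right_comm j 1 k, ← add_assoc j k 1]
    push_cast
    ring
  · simp

theorem laurentCoeff_succ_right_zero (n : ℕ) :
    laurentCoeff y n (n + 1) 0 = laurentCoeff y n n 0 + y * laurentCoeff y n n 1 := by
  have h : laurentCoeff y n n 1 =
      ∑ j ∈ Finset.range n, (n.choose j : R) * (n.choose (j + 1) : R) * y ^ j := by
    rw [laurentCoeff, Finset.sum_range_succ]
    simp
  rw [h, laurentCoeff, laurentCoeff, Finset.sum_range_succ', Finset.sum_range_succ',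
    Finset.mul_sum, add_right_comm, ← Finset.sum_add_distrib]
  congr 1
  · refine Finset.sum_congr rfl fun j _ => ?_
    rw [add_zero, Nat.choose_succ_succ' n j]
    push_cast
    ring
  · simp

end laurentCoeff

theorem jacobiA_eq_laurentCoeff {R : Type*} [CommRing R] (x : R) (n k : ℕ) :
    jacobiA (fun k => if k = 0 then 1 + x + x ^ 2 else 1 + x ^ 2) (fun _ => x ^ 2) n k =
      laurentCoeff (x ^ 2) n n k + x * laurentCoeff (x ^ 2) n n (k + 1) := by
  induction n generalizing k with
  | zero => simp [jacobiA, laurentCoeff_zero]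
  | succ n ih =>
    cases k with
    | zero =>
      simp only [jacobiA, ih, if_true, laurentCoeff_succ_left, laurentCoeff_succ_right,
        laurentCoeff_succ_right_zero]
      ring
    | succ k =>
      simp only [jacobiA, ih, Nat.add_one_ne_zero, if_false, Nat.add_sub_cancel,
        laurentCoeff_succ_left, laurentCoeff_succ_right]
      ring

theorem sum_range_two_mul {M : Type*} [AddCommMonoid M] (f : ℕ → M) (n : ℕ) :
    ∑ k ∈ Finset.range (2 * n), f k =
      ∑ j ∈ Finset.range n, f (2 * j) + ∑ j ∈ Finset.range n, f (2 * j + 1) := by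
  induction n with
  | zero => simp
  | succ n ih =>
    rw [Nat.mul_succ, Finset.sum_range_succ, Finset.sum_range_succ, ih, Finset.sum_range_succ,
      Finset.sum_range_succ]
    abel

theorem cnar_odd (n : ℕ) :
    cnar (2 * n + 1) =
      laurentCoeff (X ^ 2) n n 0 + X * laurentCoeff (X ^ 2) n n 1 := by
  have hn : 2 * n + 1 ≠ 0 := by omega
  have h_pred : (2 * n + 1 - 1) / 2 = n := by omega
  have h_half : (2 * n + 1) / 2 = n := by omega
  have h_even (j : ℕ) : 2 * j / 2 = j := by omega
  have h_odd (j : ℕ) : (2 * j + 1) / 2 = j := by omega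
  have h_next (j : ℕ) : (2 * j + 1 + 1) / 2 = j + 1 := by omega
  simp only [cnar, hn, if_false, h_pred, h_half]
  rw [show 2 * n + 1 + 1 = 2 * (n + 1) by ring, sum_range_two_mul]
  simp only [h_even, h_odd, h_next, laurentCoeff, Finset.mul_sum, Nat.cast_mul, map_mul,
    map_natCast, add_zero]
  refine congrArg₂ (· + ·) (Finset.sum_congr rfl fun j _ => ?_)
    (Finset.sum_congr rfl fun j _ => ?_) <;> ring

/-- Theorem 4: with weights `s_0 = 1 + t + t²`, `s_k = 1 + t²` for `k ≥ 1`, `t_k = t²`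
in `ℤ[t]`, the Jacobi-type array satisfies `a(n,0) = c_{2n+1}(t)`. -/
theorem jacobi_cnar_odd (n : ℕ) :
    jacobiA
        (fun k => if k = 0 then 1 + Polynomial.X + Polynomial.X ^ 2
          else 1 + Polynomial.X ^ 2)
        (fun _ => Polynomial.X ^ 2) n 0 = cnar (2 * n + 1) := by
  rw [jacobiA_eq_laurentCoeff, cnar_odd]
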